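/- Let ξ be an approximate block design satisfying ξ(0,k) = s_k(ξ)/2 for every k = 1,…,d and r_1(ξ) = … = r_v(ξ) = 1/(2v). Then N(ξ) 1_v = (1/(4v)) 1_v, the smallest eigenvalue of N(ξ) equals 1/(4v), and in particular N(ξ) is positive definite. -/

import Mathlib

open Matrix BigOperators Finset

/-- An approximate block design for `v` test treatments (labelled `1,…,v`, with
treatment `0` the control) and `d` blocks: a nonnegative weight function on
treatment-block pairs summing to one, with every block receiving positive mass. -/
structure ApproxDesign (v d : ℕ) where
  w : Fin (v + 1) → Fin d → ℝ
  nonneg : ∀ i k, 0 ≤ w i k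
  le_one : ∀ i k, w i k ≤ 1
  sum_one : ∑ i, ∑ k, w i k = 1
  blockPos : ∀ k, 0 < ∑ i, w i k

namespace ApproxDesign

variable {v d : ℕ}

/-- Block sizes `s_k(ξ)`. -/
noncomputable def s (ξ : ApproxDesign v d) (k : Fin d) : ℝ := ∑ i, ξ.w i k

/-- Treatment replications `r_i(ξ)`. -/
noncomputable def r (ξ : ApproxDesign v d) (i : Fin (v + 1)) : ℝ := ∑ k, ξ.w i k

/-- The information matrix `N(ξ) = diag(r_1,…,r_v) − Z diag(s⁻¹) Zᵀ` for comparing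
the test treatments with the control. -/
noncomputable def N (ξ : ApproxDesign v d) : Matrix (Fin v) (Fin v) ℝ :=
  Matrix.of fun i j =>
    (if i = j then ξ.r i.succ else 0) - ∑ k, ξ.w i.succ k * ξ.w j.succ k / ξ.s k

end ApproxDesign

/-- The smallest eigenvalue of a real matrix, as the infimum of its spectrum. -/
noncomputable def lamMin {n : ℕ} (A : Matrix (Fin n) (Fin n) ℝ) : ℝ :=
  sInf (spectrum ℝ A)

namespace ApproxDesign

variable {v d : ℕ}

lemma s_pos (ξ : ApproxDesign v d) (k : Fin d) : 0 < ξ.s k := ξ.blockPos k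

lemma sum_test_weights (ξ : ApproxDesign v d) (h0 : ∀ k, ξ.w 0 k = ξ.s k / 2) (k : Fin d) :
    ∑ i : Fin v, ξ.w i.succ k = ξ.s k / 2 := by
  have h : ξ.s k = ξ.w 0 k + ∑ i : Fin v, ξ.w i.succ k := Fin.sum_univ_succ _
  linarith [h0 k]

lemma N_mulVec (ξ : ApproxDesign v d) (x : Fin v → ℝ) (i : Fin v) :
    (ξ.N *ᵥ x) i =
      ξ.r i.succ * x i - ∑ k, ξ.w i.succ k * (∑ j : Fin v, ξ.w j.succ k * x j) / ξ.s k := by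
  simp only [N, mulVec, dotProduct, of_apply, sub_mul, sum_sub_distrib, ite_mul, zero_mul,
    sum_ite_eq, mem_univ, if_true, sum_mul, mul_sum, sum_div]
  rw [sum_comm]
  congr 1
  refine sum_congr rfl fun k _ => sum_congr rfl fun j _ => ?_
  ring

lemma dotProduct_N_mulVec (ξ : ApproxDesign v d) (x : Fin v → ℝ) :
    x ⬝ᵥ (ξ.N *ᵥ x) =
      ∑ i : Fin v, ξ.r i.succ * x i ^ 2 - ∑ k, (∑ j : Fin v, ξ.w j.succ k * x j) ^ 2 / ξ.s k := by
  simp only [dotProduct, N_mulVec, mul_sub, sum_sub_distrib]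
  congr 1
  · exact sum_congr rfl fun i _ => by ring
  · simp only [mul_sum (s := (univ : Finset (Fin d)))]
    rw [sum_comm]
    refine sum_congr rfl fun k _ => ?_
    rw [sq, sum_mul, sum_div]
    exact sum_congr rfl fun i _ => by ring

lemma sum_sq_div_le (ξ : ApproxDesign v d) (h0 : ∀ k, ξ.w 0 k = ξ.s k / 2) (x : Fin v → ℝ) :
    ∑ k, (∑ j : Fin v, ξ.w j.succ k * x j) ^ 2 / ξ.s k ≤
      (∑ i : Fin v, ξ.r i.succ * x i ^ 2) / 2 := by
  have hswap : (∑ i : Fin v, ξ.r i.succ * x i ^ 2) / 2 =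
      ∑ k, (∑ i : Fin v, ξ.w i.succ k * x i ^ 2) / 2 := by
    simp only [r, sum_mul, ← sum_div]
    rw [sum_comm]
  rw [hswap]
  refine sum_le_sum fun k _ => ?_
  have hcs : (∑ j : Fin v, ξ.w j.succ k * x j) ^ 2 ≤
      (∑ j : Fin v, ξ.w j.succ k) * ∑ j : Fin v, ξ.w j.succ k * x j ^ 2 :=
    sum_sq_le_sum_mul_sum_of_sq_le_mul _ (fun j _ => ξ.nonneg _ _)
      (fun j _ => mul_nonneg (ξ.nonneg _ _) (sq_nonneg _)) (fun j _ => le_of_eq (by ring))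
  rw [ξ.sum_test_weights h0] at hcs
  rw [div_le_iff₀ (ξ.s_pos k)]
  linarith

lemma le_dotProduct_N_mulVec (ξ : ApproxDesign v d) (h0 : ∀ k, ξ.w 0 k = ξ.s k / 2)
    {c : ℝ} (hr : ∀ i : Fin v, ξ.r i.succ = c) (x : Fin v → ℝ) :
    c / 2 * (x ⬝ᵥ x) ≤ x ⬝ᵥ (ξ.N *ᵥ x) := by
  have h := ξ.sum_sq_div_le h0 x
  have hx : ∑ i : Fin v, ξ.r i.succ * x i ^ 2 = c * (x ⬝ᵥ x) := by
    simp only [hr, dotProduct, mul_sum, sq]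
  rw [dotProduct_N_mulVec]
  rw [hx] at h ⊢
  linarith

lemma N_mulVec_one (ξ : ApproxDesign v d) (h0 : ∀ k, ξ.w 0 k = ξ.s k / 2)
    {c : ℝ} (hr : ∀ i : Fin v, ξ.r i.succ = c) :
    ξ.N *ᵥ (fun _ => 1) = (c / 2) • (fun _ => (1 : ℝ)) := by
  ext i
  have h : ∑ k, ξ.w i.succ k * (ξ.s k / 2) / ξ.s k = ξ.r i.succ / 2 := by
    rw [r, sum_div]
    refine sum_congr rfl fun k _ => ?_
    have := (ξ.s_pos k).ne'
    field_simp
  simp only [N_mulVec, mul_one, ξ.sum_test_weights h0, h, hr, Pi.smul_apply, smul_eq_mul]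
  ring

lemma N_isHermitian (ξ : ApproxDesign v d) : ξ.N.IsHermitian := by
  ext i j
  simp only [N, conjTranspose_apply, of_apply, star_trivial]
  by_cases hij : i = j
  · subst hij; rfl
  · simp only [hij, Ne.symm hij, if_false, mul_comm]

end ApproxDesign

lemma dotProduct_self_pos_of_ne_zero {n : ℕ} {x : Fin n → ℝ} (hx : x ≠ 0) : 0 < x ⬝ᵥ x := by
  simpa using dotProduct_star_self_pos_iff.2 hx

lemma mem_spectrum_iff_exists_mulVec_eq {n : ℕ} {A : Matrix (Fin n) (Fin n) ℝ} {μ : ℝ} :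
    μ ∈ spectrum ℝ A ↔ ∃ x ≠ 0, A *ᵥ x = μ • x := by
  rw [← spectrum_toLin', ← Module.End.hasEigenvalue_iff_mem_spectrum]
  constructor
  · intro h
    obtain ⟨x, hx⟩ := h.exists_hasEigenvector
    exact ⟨x, hx.2, by simpa using hx.apply_eq_smul⟩
  · rintro ⟨x, hx, h⟩
    exact Module.End.hasEigenvalue_of_hasEigenvector
      (Module.End.hasEigenvector_iff.2 ⟨Module.End.mem_eigenspace_iff.2 (by simpa using h), hx⟩)

lemma lamMin_eq_of_mulVec_eq {n : ℕ} {A : Matrix (Fin n) (Fin n) ℝ} {c : ℝ} {x : Fin n → ℝ}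
    (hx : x ≠ 0) (hAx : A *ᵥ x = c • x) (hA : ∀ y, c * (y ⬝ᵥ y) ≤ y ⬝ᵥ (A *ᵥ y)) :
    lamMin A = c := by
  refine IsLeast.csInf_eq ⟨mem_spectrum_iff_exists_mulVec_eq.2 ⟨x, hx, hAx⟩, fun μ hμ => ?_⟩
  obtain ⟨y, hy, hAy⟩ := mem_spectrum_iff_exists_mulVec_eq.1 hμ
  have h := hA y
  rw [hAy, dotProduct_smul, smul_eq_mul] at h
  exact le_of_mul_le_mul_right h (dotProduct_self_pos_of_ne_zero hy)

/-- If `ξ(0,k) = s_k(ξ)/2` for every `k` and `r_1 = … = r_v = 1/(2v)`,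
then `N(ξ) 1_v = (1/(4v)) 1_v`, the smallest eigenvalue of `N(ξ)` is `1/(4v)`, and
`N(ξ)` is positive definite. -/
theorem Eopt_design_properties {v d : ℕ} (hv : 1 ≤ v) (hd : 1 ≤ d)
    (ξ : ApproxDesign v d)
    (h0 : ∀ k : Fin d, ξ.w 0 k = ξ.s k / 2)
    (hr : ∀ i : Fin v, ξ.r i.succ = 1 / (2 * (v : ℝ))) :
    ApproxDesign.N ξ *ᵥ (fun _ => 1) = (1 / (4 * (v : ℝ))) • (fun _ => (1 : ℝ)) ∧
    lamMin (ApproxDesign.N ξ) = 1 / (4 * (v : ℝ)) ∧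
    (ApproxDesign.N ξ).PosDef := by
  have hv0 : (0 : ℝ) < v := by exact_mod_cast hv
  have hc : 1 / (2 * (v : ℝ)) / 2 = 1 / (4 * v) := by
    field_simp
    norm_num
  have hone := ξ.N_mulVec_one h0 hr
  have hle := ξ.le_dotProduct_N_mulVec h0 hr
  rw [hc] at hone hle
  have hne : (fun _ : Fin v => (1 : ℝ)) ≠ 0 := fun h => one_ne_zero (congrFun h ⟨0, hv⟩)
  refine ⟨hone, lamMin_eq_of_mulVec_eq hne hone hle,
    PosDef.of_dotProduct_mulVec_pos ξ.N_isHermitian fun x hx => ?_⟩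
  rw [star_trivial]
  exact lt_of_lt_of_le (mul_pos (by positivity) (dotProduct_self_pos_of_ne_zero hx)) (hle x)
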